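/- Let q : ℤ → ℂ be a finitely supported function with q(0) = 0. For an integer r ≥ 1 and a ∈ ℤ define S_r(a) := Σ q(n₁)⋯q(n_r), the (finite) sum running over all r-tuples (n₁,…,n_r) of integers with n₁ + … + n_r = a. Then for all natural numbers j and k, Σ_{a∈ℤ} a · S_{j+1}(a) · S_{k+1}(−a) = 0 (the sum over a has only finitely many nonzero terms). -/

import Mathlib

open AddMonoidAlgebra in
/-- The Euler derivation `T d/dT` on Laurent polynomials. -/
noncomputable def eulerD (x : AddMonoidAlgebra ℂ ℤ) : AddMonoidAlgebra ℂ ℤ :=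
  AddMonoidAlgebra.ofCoeff
    (Finsupp.onFinset x.coeff.support (fun a => (a : ℂ) * x.coeff a) (by
      intro a ha
      simp only [Finsupp.mem_support_iff]
      exact right_ne_zero_of_mul ha))

lemma eulerD_coeff (x : AddMonoidAlgebra ℂ ℤ) (a : ℤ) :
    (eulerD x).coeff a = (a : ℂ) * x.coeff a := rfl

lemma eulerD_zero : eulerD 0 = 0 := by
  ext a
  simp [eulerD_coeff]

lemma eulerD_add (x y : AddMonoidAlgebra ℂ ℤ) : eulerD (x + y) = eulerD x + eulerD y := by
  ext a
  simp [eulerD_coeff, mul_add]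

lemma eulerD_single (n : ℤ) (c : ℂ) :
    eulerD (AddMonoidAlgebra.single n c) = AddMonoidAlgebra.single n ((n : ℂ) * c) := by
  ext a
  rw [eulerD_coeff, AddMonoidAlgebra.coeff_single_apply, AddMonoidAlgebra.coeff_single_apply]
  split_ifs with h
  · rw [h]
  · simp

lemma eulerD_mul (x y : AddMonoidAlgebra ℂ ℤ) :
    eulerD (x * y) = eulerD x * y + x * eulerD y := by
  induction x using AddMonoidAlgebra.induction_linear with
  | zero => simp [eulerD_zero]
  | add x₁ x₂ h₁ h₂ => rw [add_mul, eulerD_add, h₁, h₂, eulerD_add]; ring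
  | single m c =>
    induction y using AddMonoidAlgebra.induction_linear with
    | zero => simp [eulerD_zero]
    | add y₁ y₂ h₁ h₂ => rw [mul_add, eulerD_add, h₁, h₂, eulerD_add]; ring
    | single n d =>
      simp only [eulerD_single, AddMonoidAlgebra.single_mul_single]
      rw [← AddMonoidAlgebra.single_add]
      congr 1
      push_cast
      ring

lemma eulerD_one : eulerD 1 = 0 := by
  have h := eulerD_mul 1 1
  simpa using h

lemma eulerD_pow (x : AddMonoidAlgebra ℂ ℤ) (n : ℕ) :
    eulerD (x ^ (n + 1)) = ((n : ℂ) + 1) • (x ^ n * eulerD x) := by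
  induction n with
  | zero => simp
  | succ n ih =>
    rw [pow_succ, eulerD_mul, ih]
    push_cast
    simp only [add_smul, one_smul, smul_mul_assoc, add_mul]
    have : x ^ n * eulerD x * x = x ^ (n + 1) * eulerD x := by ring
    rw [this]

lemma coeff_mul_at_zero (x y : AddMonoidAlgebra ℂ ℤ) :
    (x * y).coeff 0 = ∑ᶠ a : ℤ, x.coeff a * y.coeff (-a) := by
  rw [finsum_eq_sum_of_support_subset (s := x.coeff.support)]
  swap
  · intro a ha
    simp only [Finset.mem_coe, Finsupp.mem_support_iff]
    exact left_ne_zero_of_mul ha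
  change _ = x.coeff.sum (fun a c => c * y.coeff (-a))
  induction x using AddMonoidAlgebra.induction_linear with
  | zero => simp
  | add x₁ x₂ h₁ h₂ =>
    rw [add_mul, AddMonoidAlgebra.coeff_add, Finsupp.add_apply, h₁, h₂,
      AddMonoidAlgebra.coeff_add, Finsupp.sum_add_index'] <;> simp [add_mul]
  | single m c =>
    rw [AddMonoidAlgebra.coeff_single, Finsupp.sum_single_index (by simp)]
    rw [AddMonoidAlgebra.coeff_single_mul_eq_mul_coeff (m₂ := -m)]
    intro a _
    constructor <;> intro h <;> linarith

lemma prod_single_fin (r : ℕ) (q : ℤ → ℂ) (n : Fin r → ℤ) :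
    ∏ i, AddMonoidAlgebra.single (n i) (q (n i)) =
      AddMonoidAlgebra.single (∑ i, n i) (∏ i, q (n i)) := by
  induction r with
  | zero =>
    rw [Fin.prod_univ_zero, Fin.sum_univ_zero, Fin.prod_univ_zero, AddMonoidAlgebra.one_def]
  | succ r ih =>
    rw [Fin.prod_univ_succ, Fin.sum_univ_succ, Fin.prod_univ_succ,
      ih (fun i => n i.succ), AddMonoidAlgebra.single_mul_single]

lemma coeff_pow_eq (q : ℤ →₀ ℂ) (r : ℕ) (a : ℤ) :
    ((AddMonoidAlgebra.ofCoeff q) ^ r).coeff a =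
      ∑ᶠ n ∈ {n : Fin r → ℤ | ∑ i, n i = a}, ∏ i, q (n i) := by
  classical
  have hf : AddMonoidAlgebra.ofCoeff q =
      ∑ n ∈ q.support, AddMonoidAlgebra.single n (q n) :=
    (AddMonoidAlgebra.sum_coeff_single (AddMonoidAlgebra.ofCoeff q)).symm
  have hp : (AddMonoidAlgebra.ofCoeff q) ^ r =
      ∏ _i : Fin r, ∑ n ∈ q.support, AddMonoidAlgebra.single n (q n) := by
    rw [← hf]; simp
  rw [hp, Finset.prod_univ_sum, AddMonoidAlgebra.coeff_sum, Finsupp.finsetSum_apply,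
    finsum_mem_def,
    finsum_eq_sum_of_support_subset (s := Fintype.piFinset fun _ : Fin r => q.support)]
  · refine Finset.sum_congr rfl fun n _ => ?_
    rw [prod_single_fin, AddMonoidAlgebra.coeff_single_apply, Set.indicator_apply]
    rfl
  · intro n hn
    have h2 : ∏ i, q (n i) ≠ 0 := by
      intro h0
      apply hn
      simp [Set.indicator_apply, h0]
    rw [Finset.prod_ne_zero_iff] at h2
    simpa using h2

/-- Poisson-commutativity `{h¹_{S¹,j}, h¹_{S¹,k}} = 0` of the descendant
Hamiltonians of the circle at a finitely supported evaluation point: with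
`S r a = Σ_{n₁+⋯+n_r=a} q(n₁)⋯q(n_r)`, one has
`Σ_a a · S_{j+1}(a) · S_{k+1}(−a) = 0`. -/
theorem circle_hamiltonians_poisson_commute
    (q : ℤ →₀ ℂ) (hq : q 0 = 0)
    (S : ℕ → ℤ → ℂ)
    (hS : ∀ (r : ℕ) (a : ℤ),
      S r a = ∑ᶠ n ∈ {n : Fin r → ℤ | ∑ i, n i = a}, ∏ i, q (n i))
    (j k : ℕ) :
    ∑ᶠ a : ℤ, (a : ℂ) * S (j + 1) a * S (k + 1) (-a) = 0 := by
  simp only [hS, ← coeff_pow_eq, ← eulerD_coeff]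
  rw [← coeff_mul_at_zero, eulerD_pow]
  set f := AddMonoidAlgebra.ofCoeff q
  have h0 := eulerD_coeff (f ^ (j + k + 1 + 1)) 0
  rw [eulerD_pow, AddMonoidAlgebra.coeff_smul_apply] at h0
  have hne : ((j + k + 1 : ℕ) : ℂ) + 1 ≠ 0 := Nat.cast_add_one_ne_zero _
  have h1 : (f ^ (j + k + 1) * eulerD f).coeff 0 = 0 := by
    rw [Int.cast_zero, zero_mul, smul_eq_mul] at h0
    exact (mul_eq_zero.mp h0).resolve_left hne
  have h2 : f ^ j * eulerD f * f ^ (k + 1) = f ^ (j + k + 1) * eulerD f := by ring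
  rw [smul_mul_assoc, h2, AddMonoidAlgebra.coeff_smul_apply, h1, smul_zero]
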